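/- Let L ⊆ ℤ[x]^2 be the ℤ[x]-lattice generated by the single element (x − 1, 1 − x). Then the lattice σ-ideal I_L ⊆ K{y_1, y_2} is a σ-prime σ-ideal, and I_L = [y_1^{x^i} y_2 − y_1 y_2^{x^i} : i ∈ ℕ, i ≥ 1] = ⟨y_1^x y_2 − y_1 y_2^x⟩_r. -/

import Mathlib

open Polynomial

section SigmaRing

variable {R : Type*} [CommRing R]

/-- A σ-ideal: an ideal closed under the difference operator σ. -/
def IsSigmaIdeal (σ : R →+* R) (I : Ideal R) : Prop := ∀ a ∈ I, σ a ∈ I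

/-- A σ-ideal is well-mixed if `a * b ∈ I` implies `a * σ b ∈ I`. -/
def IsWellMixed (σ : R →+* R) (I : Ideal R) : Prop := ∀ a b : R, a * b ∈ I → a * σ b ∈ I

/-- `[F]`, the smallest σ-ideal containing `F`. -/
def sigmaIdealGen (σ : R →+* R) (F : Set R) : Ideal R :=
  sInf {I : Ideal R | F ⊆ I ∧ IsSigmaIdeal σ I}

/-- `⟨F⟩`, the smallest well-mixed σ-ideal containing `F` (well-mixed closure). -/
def wmClosure (σ : R →+* R) (F : Set R) : Ideal R :=
  sInf {I : Ideal R | F ⊆ I ∧ IsSigmaIdeal σ I ∧ IsWellMixed σ I}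

/-- `⟨F⟩_r`, the smallest radical well-mixed σ-ideal containing `F`. -/
def rwmClosure (σ : R →+* R) (F : Set R) : Ideal R :=
  sInf {I : Ideal R | F ⊆ I ∧ IsSigmaIdeal σ I ∧ IsWellMixed σ I ∧ I.IsRadical}

/-- Symbolic exponent: for `p = Σ c_i x^i ∈ ℕ[x]`, `a^p = Π (σ^i a)^(c_i)`. -/
noncomputable def sexp (σ : R →+* R) (a : R) (p : Polynomial ℕ) : R :=
  ∏ i ∈ Finset.range (p.natDegree + 1), ((⇑σ)^[i] a) ^ (p.coeff i)

/-- `I` is finitely generated as a radical well-mixed σ-ideal. -/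
def FinGenAsRWM (σ : R →+* R) (I : Ideal R) : Prop :=
  ∃ G : Set R, G.Finite ∧ G ⊆ (I : Set R) ∧ I = rwmClosure σ G

/-- σ-prime: a reflexive σ-ideal which is prime. -/
def IsSigmaPrime (σ : R →+* R) (I : Ideal R) : Prop :=
  IsSigmaIdeal σ I ∧ (∀ a : R, σ a ∈ I → a ∈ I) ∧ I.IsPrime

end SigmaRing

/-- The σ-polynomial ring `K{y_1,…,y_n}`: polynomials in variables `y_i^{x^j}`,
indexed by pairs `(i, j) ∈ Fin n × ℕ`. -/
abbrev DPoly (K : Type*) [Field K] (n : ℕ) := MvPolynomial (Fin n × ℕ) K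

section DPoly

variable {K : Type*} [Field K] {n : ℕ} (σK : K →+* K)

/-- The difference operator on `K{y_1,…,y_n}` extending `σK`, with `σ(y_i^{x^j}) = y_i^{x^{j+1}}`. -/
noncomputable def shift : DPoly K n →+* DPoly K n :=
  MvPolynomial.eval₂Hom ((MvPolynomial.C : K →+* DPoly K n).comp σK)
    (fun v => MvPolynomial.X (v.1, v.2 + 1))

/-- `y_i^p` for `p ∈ ℕ[x]`. -/
noncomputable def ypow (i : Fin n) (p : Polynomial ℕ) : DPoly K n :=
  sexp (shift σK) (MvPolynomial.X (i, 0)) p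

/-- `y_i^{x^a}`. -/
noncomputable def varPow (i : Fin n) (a : ℕ) : DPoly K n :=
  ypow σK i (Polynomial.X ^ a)

/-- The monomial `Y^f = Π y_i^{f_i}` for `f ∈ ℕ[x]^n`. -/
noncomputable def monom (f : Fin n → Polynomial ℕ) : DPoly K n :=
  ∏ i, ypow σK i (f i)

/-- A pure binomial `Y^f − Y^g`. -/
def IsPureBinomial (p : DPoly K n) : Prop :=
  ∃ f g : Fin n → Polynomial ℕ, p = monom σK f - monom σK g

/-- A binomial `a·Y^f + b·Y^g` with `a, b ∈ K^×`. -/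
def IsBinomial (p : DPoly K n) : Prop :=
  ∃ (a b : K) (f g : Fin n → Polynomial ℕ), a ≠ 0 ∧ b ≠ 0 ∧
    p = MvPolynomial.C a * monom σK f + MvPolynomial.C b * monom σK g

/-- A pure binomial σ-ideal: a σ-ideal generated by pure binomials. -/
def IsPureBinomialSigmaIdeal (I : Ideal (DPoly K n)) : Prop :=
  ∃ S : Set (DPoly K n), (∀ p ∈ S, IsPureBinomial σK p) ∧ I = sigmaIdealGen (shift σK) S

/-- Positive part of `f ∈ ℤ[x]`. -/
noncomputable def posPart (f : Polynomial ℤ) : Polynomial ℕ :=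
  f.sum fun i c => Polynomial.monomial i c.toNat

/-- Negative part of `f ∈ ℤ[x]`. -/
noncomputable def negPart (f : Polynomial ℤ) : Polynomial ℕ :=
  f.sum fun i c => Polynomial.monomial i (-c).toNat

/-- The lattice σ-ideal `I_L = [Y^{f_+} − Y^{f_−} : f ∈ L]` of a ℤ[x]-lattice `L ⊆ ℤ[x]^n`. -/
noncomputable def latticeIdeal (L : Submodule (Polynomial ℤ) (Fin n → Polynomial ℤ)) :
    Ideal (DPoly K n) :=
  sigmaIdealGen (shift σK)
    {p | ∃ f ∈ L, p = monom σK (fun i => posPart (f i)) - monom σK (fun i => negPart (f i))}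

end DPoly

/-- `𝔪`: the multiplicatively closed set generated by the variables `y_i^{x^j}`. -/
def mSet (K : Type*) [Field K] (n : ℕ) : Set (DPoly K n) :=
  (Submonoid.closure (Set.range fun v : Fin n × ℕ => (MvPolynomial.X v : DPoly K n)) : Set _)

/-- `I : 𝔪 = {p : M p ∈ I for some M ∈ 𝔪}`. -/
def colonM {K : Type*} [Field K] {n : ℕ} (I : Ideal (DPoly K n)) : Set (DPoly K n) :=
  {p | ∃ M ∈ mSet K n, M * p ∈ I}

section Tsec

variable {K : Type*} [Field K] {n t : ℕ} (σK : K →+* K)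

/-- The set `T^{a_1…a_t}_{j_1…j_t}` of monomials `Y^f` with `deg f_{j_i} < a_i`. -/
def Tset (j : Fin t → Fin n) (a : Fin t → ℕ) : Set (DPoly K n) :=
  {p | ∃ f : Fin n → Polynomial ℕ,
    (∀ i : Fin t, (f (j i)).degree < (a i : WithBot ℕ)) ∧ p = monom σK f}

/-- `I` is saturated with respect to `{y_{j_1}^{x^{a_1}},…,y_{j_t}^{x^{a_t}}}`. -/
def SaturatedWrt (j : Fin t → Fin n) (a : Fin t → ℕ) (I : Ideal (DPoly K n)) : Prop :=
  ∀ g M : DPoly K n, M ∈ Tset σK j a → M * g ∈ I → g ∈ I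

/-- `J : T = {g : M g ∈ J for some M ∈ T}`. -/
def colonT (j : Fin t → Fin n) (a : Fin t → ℕ) (J : Ideal (DPoly K n)) : Set (DPoly K n) :=
  {g | ∃ M ∈ Tset σK j a, M * g ∈ J}

/-- The `T`-saturated closure `N^{a_1…a_t}_{j_1…j_t}(I)`: the smallest saturated σ-ideal
containing `I`. -/
noncomputable def Nclosure (j : Fin t → Fin n) (a : Fin t → ℕ) (I : Ideal (DPoly K n)) :
    Ideal (DPoly K n) :=
  sInf {J : Ideal (DPoly K n) | I ≤ J ∧ IsSigmaIdeal (shift σK) J ∧ SaturatedWrt σK j a J}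

/-- The set of variables `{y_{j_1}^{x^{a_1}},…,y_{j_t}^{x^{a_t}}}`. -/
noncomputable def varSet (j : Fin t → Fin n) (a : Fin t → ℕ) : Set (DPoly K n) :=
  Set.range fun i => varPow σK (j i) (a i)

/-- `⟨I₀ ∪ {y_{j_1}^{x^{a_1}},…,y_{j_t}^{x^{a_t}}}⟩_r` is quasi-normal. -/
def QuasiNormal (j : Fin t → Fin n) (a : Fin t → ℕ) (I0 : Ideal (DPoly K n)) : Prop :=
  SaturatedWrt σK j a I0 ∧
  ∀ f g : Fin n → Polynomial ℕ, monom σK f - monom σK g ∈ I0 →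
    monom σK f ∈ sigmaIdealGen (shift σK) (varSet σK j a) →
    monom σK g ∈ sigmaIdealGen (shift σK) (varSet σK j a)

end Tsec

section SigmaIdealLemmas

variable {R : Type*} [CommRing R] {σ : R →+* R}

theorem subset_sigmaIdealGen (F : Set R) : F ⊆ sigmaIdealGen σ F := fun _ hp =>
  Ideal.mem_sInf.2 fun _ hI => hI.1 hp

theorem isSigmaIdeal_sigmaIdealGen (F : Set R) : IsSigmaIdeal σ (sigmaIdealGen σ F) :=
  fun _ ha => Ideal.mem_sInf.2 fun _ hI => hI.2 _ (Ideal.mem_sInf.1 ha hI)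

theorem sigmaIdealGen_le {F : Set R} {I : Ideal R} (hF : F ⊆ I) (hI : IsSigmaIdeal σ I) :
    sigmaIdealGen σ F ≤ I := sInf_le ⟨hF, hI⟩

theorem IsSigmaIdeal.iterate_mem {I : Ideal R} (hI : IsSigmaIdeal σ I) {a : R} (ha : a ∈ I)
    (k : ℕ) : (⇑σ)^[k] a ∈ I := by
  induction k with
  | zero => exact ha
  | succ k ih => rw [Function.iterate_succ_apply']; exact hI _ ih

theorem IsWellMixed.mul_iterate_mem {I : Ideal R} (hI : IsWellMixed σ I) {a b : R}
    (h : a * b ∈ I) (k : ℕ) : a * (⇑σ)^[k] b ∈ I := by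
  induction k with
  | zero => exact h
  | succ k ih => rw [Function.iterate_succ_apply']; exact hI _ _ ih

theorem rwmClosure_le_of_isSigmaPrime {F : Set R} {I : Ideal R} (hF : F ⊆ I)
    (hI : IsSigmaPrime σ I) : rwmClosure σ F ≤ I := by
  refine sInf_le ⟨hF, hI.1, fun a b hab => ?_, hI.2.2.isRadical⟩
  rcases hI.2.2.mem_or_mem hab with h | h
  · exact I.mul_mem_right _ h
  · exact I.mul_mem_left _ (hI.1 _ h)

theorem map_sexp {S : Type*} [CommRing S] {τ : S →+* S} (φ : R →+* S)
    (h : ∀ a, φ (σ a) = τ (φ a)) (a : R) (p : Polynomial ℕ) :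
    φ (sexp σ a p) = sexp τ (φ a) p := by
  have key : ∀ i, φ ((⇑σ)^[i] a) = (⇑τ)^[i] (φ a) := fun i => Function.Semiconj.iterate_right h i a
  simp [sexp, map_prod, key]

theorem sexp_mul (a b : R) (p : Polynomial ℕ) :
    sexp σ (a * b) p = sexp σ a p * sexp σ b p := by
  simp [sexp, iterate_map_mul, mul_pow, Finset.prod_mul_distrib]

theorem sexp_of_fixed {a : R} (h : σ a = a) (p : Polynomial ℕ) :
    sexp σ a p = a ^ p.eval 1 := by
  simp [sexp, Function.iterate_fixed h, Finset.prod_pow_eq_pow_sum, Polynomial.eval_eq_sum_range]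

theorem sexp_X_pow (a : R) (k : ℕ) : sexp σ a (Polynomial.X ^ k) = (⇑σ)^[k] a := by
  rw [sexp, Finset.prod_eq_single k]
  · simp
  · intro i _ hi
    simp [Polynomial.coeff_X_pow, hi]
  · simp

end SigmaIdealLemmas

section PosNegParts

theorem coeff_posPart (f : Polynomial ℤ) (i : ℕ) : (posPart f).coeff i = (f.coeff i).toNat := by
  rw [_root_.posPart.eq_1, Polynomial.sum_def, Polynomial.finsetSum_coeff]
  simp only [Polynomial.coeff_monomial]
  rw [Finset.sum_ite_eq']
  split_ifs with h
  · rfl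
  · simp [Polynomial.notMem_support_iff.1 h]

theorem coeff_negPart (f : Polynomial ℤ) (i : ℕ) :
    (negPart f).coeff i = (-f.coeff i).toNat := by
  rw [_root_.negPart.eq_1, Polynomial.sum_def, Polynomial.finsetSum_coeff]
  simp only [Polynomial.coeff_monomial]
  rw [Finset.sum_ite_eq']
  split_ifs with h
  · rfl
  · simp [Polynomial.notMem_support_iff.1 h]

theorem posPart_poly_neg (f : Polynomial ℤ) : posPart (-f) = negPart f := by
  ext i; simp [coeff_posPart, coeff_negPart]

theorem negPart_poly_neg (f : Polynomial ℤ) : negPart (-f) = posPart f := by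
  ext i; simp [coeff_posPart, coeff_negPart]

theorem map_posPart_sub_map_negPart (f : Polynomial ℤ) :
    (posPart f).map (Nat.castRingHom ℤ) - (negPart f).map (Nat.castRingHom ℤ) = f := by
  ext i
  simp only [Polynomial.coeff_sub, Polynomial.coeff_map, coeff_posPart, coeff_negPart,
    eq_natCast]
  omega

theorem eval_one_posPart_eq_negPart {f : Polynomial ℤ} (hf : f.eval 1 = 0) :
    (posPart f).eval 1 = (negPart f).eval 1 := by
  have h := congrArg (Polynomial.eval 1) (map_posPart_sub_map_negPart f)
  rw [hf, Polynomial.eval_sub, Polynomial.eval_one_map, Polynomial.eval_one_map, sub_eq_zero] at h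
  exact Nat.cast_injective h

theorem posPart_X_pow_sub_one {i : ℕ} (hi : 1 ≤ i) :
    posPart ((Polynomial.X : Polynomial ℤ) ^ i - 1) = Polynomial.X ^ i := by
  ext j
  simp only [coeff_posPart, Polynomial.coeff_sub, Polynomial.coeff_X_pow, Polynomial.coeff_one]
  split_ifs <;> first | rfl | omega

theorem negPart_X_pow_sub_one {i : ℕ} (hi : 1 ≤ i) :
    negPart ((Polynomial.X : Polynomial ℤ) ^ i - 1) = Polynomial.X ^ 0 := by
  ext j
  simp only [coeff_negPart, Polynomial.coeff_sub, Polynomial.coeff_X_pow, Polynomial.coeff_one]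
  split_ifs <;> first | rfl | omega

end PosNegParts

section Minors

open MvPolynomial

variable {K : Type*} [Field K] (σK : K →+* K)

@[simp] theorem shift_X {n : ℕ} (v : Fin n × ℕ) :
    shift σK (X v : DPoly K n) = X (v.1, v.2 + 1) := by
  simp [shift]

theorem shift_iterate_X {n : ℕ} (i : Fin n) (j k : ℕ) :
    (⇑(shift σK))^[k] (X (i, j) : DPoly K n) = X (i, j + k) := by
  induction k with
  | zero => rfl
  | succ k ih => rw [Function.iterate_succ_apply', ih, shift_X, add_assoc]

theorem varPow_eq_X {n : ℕ} (i : Fin n) (k : ℕ) :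
    varPow σK i k = (X (i, k) : DPoly K n) := by
  rw [varPow, ypow, sexp_X_pow, shift_iterate_X, zero_add]

variable (K) in
/-- The `2 × 2` minor of the columns `i, j` of the matrix `(y_k^{x^j})`. -/
noncomputable def minor (i j : ℕ) : DPoly K 2 := X (0, i) * X (1, j) - X (0, j) * X (1, i)

theorem shift_iterate_minor (i j k : ℕ) :
    (⇑(shift σK))^[k] (minor K i j) = minor K (i + k) (j + k) := by
  simp [minor, iterate_map_sub, iterate_map_mul, shift_iterate_X]

theorem minor_mem_of_minor_zero_mem {I : Ideal (DPoly K 2)} (hI : IsSigmaIdeal (shift σK) I)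
    (h : ∀ i, 1 ≤ i → minor K i 0 ∈ I) (i j : ℕ) : minor K i j ∈ I := by
  have hlt : ∀ {i j}, j < i → minor K i j ∈ I := fun {i j} hij => by
    have := hI.iterate_mem (h (i - j) (by omega)) j
    rwa [shift_iterate_minor, Nat.sub_add_cancel hij.le, zero_add] at this
  rcases lt_trichotomy j i with hij | rfl | hij
  · exact hlt hij
  · simp [minor]
  · rw [show minor K i j = -minor K j i by simp only [minor]; ring]
    exact I.neg_mem (hlt hij)

/-- A radical well-mixed σ-ideal containing the first minor contains them all. -/
theorem minor_zero_mem_of_isWellMixed {I : Ideal (DPoly K 2)} (hI : IsSigmaIdeal (shift σK) I)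
    (hwm : IsWellMixed (shift σK) I) (hrad : I.IsRadical) (h : minor K 1 0 ∈ I) (n : ℕ) :
    minor K n 0 ∈ I := by
  induction n with
  | zero => simp [minor]
  | succ n ih =>
    have hs : minor K (n + 1) 1 ∈ I := by
      have := hI.iterate_mem ih 1
      rwa [shift_iterate_minor, zero_add] at this
    have hmul : ∀ i : Fin 2, minor K (n + 1) 0 * X (i, n + 1) ∈ I := fun i => by
      have h1 : minor K (n + 1) 0 * X (i, 1) ∈ I := by
        have : minor K (n + 1) 0 * X (i, 1) =
            X (i, 0) * minor K (n + 1) 1 + X (i, n + 1) * minor K 1 0 := by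
          obtain rfl | rfl : i = 0 ∨ i = 1 := by omega
          all_goals simp only [minor]; ring
        rw [this]
        exact I.add_mem (I.mul_mem_left _ hs) (I.mul_mem_left _ h)
      have := hwm.mul_iterate_mem h1 n
      rwa [shift_iterate_X, add_comm 1] at this
    refine hrad ⟨2, ?_⟩
    have : minor K (n + 1) 0 ^ 2 = minor K (n + 1) 0 * X (0, n + 1) * X (1, 0) -
        minor K (n + 1) 0 * X (1, n + 1) * X (0, 0) := by
      rw [sq]; nth_rw 2 [minor]; ring
    rw [this]
    exact I.sub_mem (I.mul_mem_right _ (hmul 0)) (I.mul_mem_right _ (hmul 1))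

variable (K) in
/-- The parametrization `y_i^{x^j} ↦ t_j s_i` of the variety of `2 × ∞` matrices of rank one. -/
noncomputable def segre : DPoly K 2 →ₐ[K] MvPolynomial (ℕ ⊕ Fin 2) K :=
  aeval fun v => X (Sum.inl v.2) * X (Sum.inr v.1)

/-- The difference operator `t_j ↦ t_{j+1}`, `s_i ↦ s_i` on the parameter ring. -/
noncomputable def paramShift : MvPolynomial (ℕ ⊕ Fin 2) K →+* MvPolynomial (ℕ ⊕ Fin 2) K :=
  (rename (R := K) (Sum.map Nat.succ id : ℕ ⊕ Fin 2 → ℕ ⊕ Fin 2)).toRingHom.comp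
    (MvPolynomial.map σK)

theorem paramShift_injective : Function.Injective (paramShift (K := K) σK) :=
  (rename_injective _ (Sum.map_injective.2 ⟨Nat.succ_injective, Function.injective_id⟩)).comp
    (map_injective _ σK.injective)

theorem segre_shift (p : DPoly K 2) : segre K (shift σK p) = paramShift σK (segre K p) := by
  have : (segre K).toRingHom.comp (shift σK) = (paramShift σK).comp (segre K).toRingHom := by
    refine MvPolynomial.ringHom_ext (fun c => ?_) fun v => ?_
    · simp [segre, paramShift, shift, algebraMap_eq]
    · simp [segre, paramShift]
  exact RingHom.congr_fun this p

theorem isSigmaPrime_ker_segre : IsSigmaPrime (shift σK) (RingHom.ker (segre K)) := by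
  refine ⟨fun a ha => ?_, fun a ha => ?_, RingHom.ker_isPrime _⟩
  · rw [RingHom.mem_ker] at ha ⊢
    rw [segre_shift, ha, map_zero]
  · rw [RingHom.mem_ker, segre_shift] at ha
    exact paramShift_injective σK (ha.trans (map_zero _).symm)

theorem minor_mem_ker_segre (i j : ℕ) : minor K i j ∈ RingHom.ker (segre K) := by
  simp only [RingHom.mem_ker, minor, segre, map_sub, map_mul, MvPolynomial.aeval_X]
  ring

theorem segre_ypow (i : Fin 2) (p : Polynomial ℕ) :
    segre K (ypow σK i p) =
      sexp (paramShift σK) (X (Sum.inl 0)) p * X (Sum.inr i) ^ p.eval 1 := by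
  have h := map_sexp (segre K).toRingHom (segre_shift σK) (X (i, 0)) p
  have hX : (segre K).toRingHom (X (i, 0)) = X (Sum.inl 0) * X (Sum.inr i) := by simp [segre]
  rw [hX, sexp_mul, sexp_of_fixed (a := X (Sum.inr i)) (by simp [paramShift])] at h
  exact h

theorem monom_sub_monom_mem_ker_segre {f : Fin 2 → Polynomial ℤ} (h0 : (f 0).eval 1 = 0)
    (h1 : f 1 = -f 0) :
    monom σK (fun i => posPart (f i)) - monom σK (fun i => negPart (f i)) ∈
      RingHom.ker (segre K) := by
  simp only [RingHom.mem_ker, monom, map_sub, Fin.prod_univ_two, map_mul, segre_ypow, h1,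
    posPart_poly_neg, negPart_poly_neg, eval_one_posPart_eq_negPart h0]
  ring

/-- The exponent of the image of a monomial under `segre`. -/
noncomputable def segreExp : (Fin 2 × ℕ →₀ ℕ) →+ (ℕ ⊕ Fin 2 →₀ ℕ) :=
  Finsupp.liftAddHom fun v =>
    (Finsupp.singleAddHom (Sum.inl v.2)) + Finsupp.singleAddHom (Sum.inr v.1)

theorem segreExp_single (v : Fin 2 × ℕ) (k : ℕ) :
    segreExp (Finsupp.single v k) =
      Finsupp.single (Sum.inl v.2) k + Finsupp.single (Sum.inr v.1) k := by
  simp [segreExp]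

theorem segre_monomial (e : Fin 2 × ℕ →₀ ℕ) (c : K) :
    segre K (monomial e c) = monomial (segreExp e) c := by
  induction e using Finsupp.induction_linear generalizing c with
  | zero => simp [segre, algebraMap_eq]
  | add e e' he he' =>
    have : ∀ d d' : Fin 2 × ℕ →₀ ℕ, monomial (d + d') c = monomial d c * monomial d' (1 : K) :=
      fun d d' => by rw [monomial_mul, mul_one]
    rw [this, map_mul, he, he', monomial_mul, mul_one, map_add]
  | single v k =>
    rw [segreExp_single, segre, MvPolynomial.aeval_monomial, Finsupp.prod_single_index (by simp),
      mul_pow, MvPolynomial.X_pow_eq_monomial, MvPolynomial.X_pow_eq_monomial, monomial_mul,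
      algebraMap_eq, MvPolynomial.C_mul_monomial]
    simp

theorem segreExp_inl (e : Fin 2 × ℕ →₀ ℕ) (j : ℕ) :
    segreExp e (Sum.inl j) = e (0, j) + e (1, j) := by
  induction e using Finsupp.induction_linear with
  | zero => simp
  | add e e' he he' => simp only [map_add, Finsupp.add_apply, he, he']; ring
  | single v k =>
    obtain ⟨i, l⟩ := v
    fin_cases i <;> simp [segreExp_single, Finsupp.single_apply]

theorem segreExp_inr_eq_zero_iff (e : Fin 2 × ℕ →₀ ℕ) (i : Fin 2) :
    segreExp e (Sum.inr i) = 0 ↔ ∀ j, e (i, j) = 0 := by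
  induction e using Finsupp.induction_linear with
  | zero => simp
  | add e e' he he' => simp [he, he', forall_and]
  | single v k =>
    obtain ⟨l, m⟩ := v
    by_cases hl : l = i
    · subst hl
      simp only [segreExp_single, Finsupp.add_apply, Finsupp.single_apply]
      simp only [reduceCtorEq, if_false, if_true, zero_add, Prod.mk.injEq, true_and]
      exact ⟨fun h => by simp [h], fun h => by simpa using h m⟩
    · simp [segreExp_single, hl]

/-- Monomials with the same image under `segre` agree modulo the minors. -/
theorem monomial_sub_monomial_mem {I : Ideal (DPoly K 2)} (hI : ∀ i j, minor K i j ∈ I)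
    (e e' : Fin 2 × ℕ →₀ ℕ) (h : segreExp e = segreExp e') :
    monomial e (1 : K) - monomial e' 1 ∈ I := by
  have hinl (j : ℕ) : e (0, j) + e (1, j) = e' (0, j) + e' (1, j) := by
    rw [← segreExp_inl, h, segreExp_inl]
  have hinr : (∀ j, e (0, j) = 0) ↔ ∀ j, e' (0, j) = 0 := by
    rw [← segreExp_inr_eq_zero_iff, h, segreExp_inr_eq_zero_iff]
  by_cases h0 : ∀ j, e (0, j) = 0
  · have h0' := hinr.1 h0
    have : e = e' := by
      ext ⟨i, j⟩
      have := hinl j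
      obtain rfl | rfl : i = 0 ∨ i = 1 := by omega
      · rw [h0, h0']
      · simpa [h0, h0'] using this
    simp [this]
  obtain ⟨j, hj⟩ := not_forall.1 h0
  have cancel {f : Fin 2 × ℕ →₀ ℕ} (hf : segreExp e = segreExp f) (hfj : f (0, j) ≠ 0) :
      monomial e (1 : K) - monomial f 1 ∈ I := by
    obtain ⟨d, hd⟩ := exists_add_of_le (Finsupp.single_le_iff.2 (Nat.one_le_iff_ne_zero.2 hj))
    obtain ⟨d', hd'⟩ := exists_add_of_le (Finsupp.single_le_iff.2 (Nat.one_le_iff_ne_zero.2 hfj))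
    have hdd : segreExp d = segreExp d' := by
      rw [hd, hd', map_add, map_add] at hf
      exact add_left_cancel hf
    have hlt : d.degree < e.degree := by
      rw [hd, map_add, Finsupp.degree_single]; omega
    have hmem := monomial_sub_monomial_mem hI d d' hdd
    rw [hd, hd', monomial_single_add, monomial_single_add, ← mul_sub]
    exact I.mul_mem_left _ hmem
  by_cases hj' : e' (0, j) = 0
  · obtain ⟨k, hk⟩ := not_forall.1 (mt hinr.2 h0)
    have h1 : e' (1, j) ≠ 0 := by have := hinl j; omega
    obtain ⟨d, hd⟩ := exists_add_of_le (Finsupp.single_le_iff.2 (Nat.one_le_iff_ne_zero.2 hk))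
    have hd1 : d (1, j) ≠ 0 := by simpa [hd] using h1
    obtain ⟨c, rfl⟩ := exists_add_of_le (Finsupp.single_le_iff.2 (Nat.one_le_iff_ne_zero.2 hd1))
    have hswap := cancel (f := Finsupp.single (0, j) 1 + (Finsupp.single (1, k) 1 + c))
      (by rw [h, hd]; simp only [map_add, segreExp_single]; abel) (by simp)
    have hminor : MvPolynomial.monomial
        (Finsupp.single ((0 : Fin 2), j) 1 + (Finsupp.single (1, k) 1 + c)) (1 : K) -
        monomial e' 1 = minor K j k * monomial c 1 := by
      simp only [hd, monomial_single_add, pow_one, minor]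
      ring
    rw [← sub_add_sub_cancel, hminor]
    exact I.add_mem hswap (I.mul_mem_right _ (hI j k))
  · exact cancel h hj'
termination_by e.degree

theorem ker_segre_le {I : Ideal (DPoly K 2)} (hI : ∀ i j, minor K i j ∈ I) :
    RingHom.ker (segre K) ≤ I := by
  intro p hp
  let ψ : MvPolynomial (ℕ ⊕ Fin 2) K →ₗ[K] DPoly K 2 :=
    (MvPolynomial.basisMonomials _ K).constr K fun v =>
      monomial (Function.invFun segreExp v) (1 : K)
  have key : ∀ q : DPoly K 2, q - ψ (segre K q) ∈ I := fun q => by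
    induction q using MvPolynomial.induction_on' with
    | monomial e c =>
      have hc {τ : Type} (d : τ →₀ ℕ) : monomial d c = c • monomial d (1 : K) := by
        rw [MvPolynomial.smul_monomial, smul_eq_mul, mul_one]
      have hψ (d) : ψ (monomial d 1) = monomial (Function.invFun segreExp d) (1 : K) := by
        simpa using (MvPolynomial.basisMonomials _ K).constr_basis K _ d
      rw [segre_monomial, hc e, hc (segreExp e), map_smul, hψ, ← smul_sub]
      exact I.smul_of_tower_mem c
        (monomial_sub_monomial_mem hI _ _ (Function.invFun_eq ⟨e, rfl⟩).symm)
    | add p q hp hq =>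
      rw [map_add, map_add, add_sub_add_comm]
      exact I.add_mem hp hq
  simpa [RingHom.mem_ker.1 hp] using key p

theorem monom_X_pow_sub_one {i : ℕ} (hi : 1 ≤ i) (f : Fin 2 → Polynomial ℤ)
    (h0 : f 0 = Polynomial.X ^ i - 1) (h1 : f 1 = -f 0) :
    monom σK (fun i => posPart (f i)) - monom σK (fun i => negPart (f i)) = minor K i 0 := by
  have hv : ∀ (a : Fin 2) (k : ℕ), ypow σK a (Polynomial.X ^ k) = (X (a, k) : DPoly K 2) :=
    varPow_eq_X σK
  simp only [monom, Fin.prod_univ_two, h1, posPart_poly_neg, negPart_poly_neg, h0,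
    posPart_X_pow_sub_one hi, negPart_X_pow_sub_one hi, hv, minor]

end Minors

/-- For `L = (x−1, 1−x) ⊆ ℤ[x]²`, `I_L` is σ-prime and
`I_L = [y_1^{x^i} y_2 − y_1 y_2^{x^i} : i ≥ 1] = ⟨y_1^x y_2 − y_1 y_2^x⟩_r`. -/
theorem stmt14 {K : Type*} [Field K] [CharZero K] (σK : K →+* K)
    (L : Submodule (Polynomial ℤ) (Fin 2 → Polynomial ℤ))
    (hL : L = Submodule.span (Polynomial ℤ)
      {![(Polynomial.X : Polynomial ℤ) - 1, 1 - Polynomial.X]}) :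
    IsSigmaPrime (shift σK) (latticeIdeal σK L) ∧
    latticeIdeal σK L = sigmaIdealGen (shift σK)
      {p : DPoly K 2 | ∃ i : ℕ, 1 ≤ i ∧
        p = varPow σK 0 i * varPow σK 1 0 - varPow σK 0 0 * varPow σK 1 i} ∧
    latticeIdeal σK L = rwmClosure (shift σK)
      {varPow σK 0 1 * varPow σK 1 0 - varPow σK 0 0 * varPow σK 1 1} := by
  have hminor (i : ℕ) : varPow σK 0 i * varPow σK 1 0 - varPow σK 0 0 * varPow σK 1 i =
      minor K i 0 := by simp only [varPow_eq_X, minor]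
  simp only [hminor]
  set J := sigmaIdealGen (shift σK) {p : DPoly K 2 | ∃ i : ℕ, 1 ≤ i ∧ p = minor K i 0}
  have hJ : J ≤ latticeIdeal σK L := by
    refine sigmaIdealGen_le ?_ (isSigmaIdeal_sigmaIdealGen _)
    rintro _ ⟨i, hi, rfl⟩
    obtain ⟨q, hq⟩ := sub_dvd_pow_sub_pow (Polynomial.X : Polynomial ℤ) 1 i
    rw [one_pow] at hq
    refine subset_sigmaIdealGen _ ⟨q • ![Polynomial.X - 1, 1 - Polynomial.X], ?_, ?_⟩
    · rw [hL]
      exact Submodule.smul_mem _ _ (Submodule.mem_span_singleton_self _)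
    · refine (monom_X_pow_sub_one σK hi _ ?_ ?_).symm
      · simp [hq, mul_comm]
      · simp [← mul_neg]
  have hlat : latticeIdeal σK L ≤ RingHom.ker (segre K) := by
    refine sigmaIdealGen_le ?_ (isSigmaPrime_ker_segre σK).1
    rintro _ ⟨f, hf, rfl⟩
    rw [hL, Submodule.mem_span_singleton] at hf
    obtain ⟨q, rfl⟩ := hf
    refine monom_sub_monom_mem_ker_segre σK ?_ ?_
    · simp
    · simp [← mul_neg]
  have hker {I : Ideal (DPoly K 2)} (hI : IsSigmaIdeal (shift σK) I)
      (h : ∀ i, 1 ≤ i → minor K i 0 ∈ I) : RingHom.ker (segre K) ≤ I :=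
    ker_segre_le (minor_mem_of_minor_zero_mem σK hI h)
  have hkerJ : RingHom.ker (segre K) ≤ J :=
    hker (isSigmaIdeal_sigmaIdealGen _) fun i hi => subset_sigmaIdealGen _ ⟨i, hi, rfl⟩
  have heq : latticeIdeal σK L = RingHom.ker (segre K) := hlat.antisymm (hkerJ.trans hJ)
  refine ⟨heq ▸ isSigmaPrime_ker_segre σK, (hlat.trans hkerJ).antisymm hJ, ?_⟩
  rw [heq]
  refine le_antisymm (le_sInf ?_) (rwmClosure_le_of_isSigmaPrime ?_ (isSigmaPrime_ker_segre σK))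
  · rintro I ⟨hF, hI, hwm, hrad⟩
    exact hker hI fun i _ => minor_zero_mem_of_isWellMixed σK hI hwm hrad (hF rfl) i
  · rintro _ rfl
    exact minor_mem_ker_segre 1 0
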